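/- arXiv:2511.16918 — 2 statements merged into one kernel-verified Lean document; each statement's English description precedes it below -/
import Mathlib

section
/- Let G = (V,E) be a finite simple graph, let λ > 0, let v ∈ V, and let τ = (B₊, B₋) be a vertex pinning with v ∉ B₊ ∪ B₋ such that both events {M satisfies τ and v is covered by M} and {M satisfies τ and v is not covered by M} have positive probability under μ_{G,λ}. Then there exists a coupling π of the conditional distribution of M given (τ and v covered) and the conditional distribution of M given (τ and v uncovered) such that E_{(M,M') ∼ π}[ |V(M) △ V(M')| ] ≤ 2. (Consequently, the distribution of the matched-vertex set V(M) under μ_{G,λ} is 2-spectrally independent.) -/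
open scoped Classical

namespace SensMatching

variable {V : Type*} [Fintype V] [DecidableEq V]

/-- `M` is a matching of `G`: a finset of edges of `G`, no two of which share an endpoint. -/
def IsMatchingSet (G : SimpleGraph V) (M : Finset (Sym2 V)) : Prop :=
  (∀ e ∈ M, e ∈ G.edgeSet) ∧
    ∀ e ∈ M, ∀ f ∈ M, e ≠ f → ∀ v : V, v ∈ e → v ∉ f

/-- The finset of all matchings of `G`. -/
noncomputable def matchings (G : SimpleGraph V) : Finset (Finset (Sym2 V)) :=
  Finset.univ.filter fun M => IsMatchingSet G M

/-- `ν(G)`: the maximum size of a matching of `G`. -/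
noncomputable def nu (G : SimpleGraph V) : ℕ :=
  (matchings G).sup Finset.card

/-- `m_k(G)`: the number of matchings of size `k` in `G`. -/
noncomputable def numMatchings (G : SimpleGraph V) (k : ℕ) : ℕ :=
  ((matchings G).filter fun M => M.card = k).card

/-- The degree of a vertex `v` in `G`. -/
noncomputable def degr (G : SimpleGraph V) (v : V) : ℕ :=
  (Finset.univ.filter fun w => G.Adj v w).card

/-- The finset of edges of `G`. -/
noncomputable def edges (G : SimpleGraph V) : Finset (Sym2 V) :=
  Finset.univ.filter fun e => e ∈ G.edgeSet

/-- The partition function `Z_G(λ) = Σ_{M matching} λ^{|M|}`. -/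
noncomputable def partitionFn (G : SimpleGraph V) (lam : ℝ) : ℝ :=
  ∑ M ∈ matchings G, lam ^ M.card

/-- The probability, under the Gibbs distribution `μ_{G,λ}`, of the event `p`. -/
noncomputable def gibbsProb (G : SimpleGraph V) (lam : ℝ) (p : Finset (Sym2 V) → Prop) : ℝ :=
  (∑ M ∈ (matchings G).filter p, lam ^ M.card) / partitionFn G lam

/-- The law of `f M`, where `M` follows the Gibbs distribution `μ_{G,λ}` conditioned
on the event `p`. -/
noncomputable def condDistMap (G : SimpleGraph V) (lam : ℝ) (p : Finset (Sym2 V) → Prop)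
    (f : Finset (Sym2 V) → Finset (Sym2 V)) (N : Finset (Sym2 V)) : ℝ :=
  (∑ M ∈ ((matchings G).filter p).filter fun M => f M = N, lam ^ M.card) /
    ∑ M ∈ (matchings G).filter p, lam ^ M.card

/-- The Gibbs distribution `μ_{G,λ}` conditioned on the event `p`. -/
noncomputable def condDist (G : SimpleGraph V) (lam : ℝ) (p : Finset (Sym2 V) → Prop) :
    Finset (Sym2 V) → ℝ :=
  condDistMap G lam p id

/-- The Gibbs distribution `μ_{G,λ}` over matchings of `G`. -/
noncomputable def gibbsDist (G : SimpleGraph V) (lam : ℝ) : Finset (Sym2 V) → ℝ :=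
  condDist G lam fun _ => True

/-- `V(M)`: the set of vertices covered by the edge set `M`. -/
noncomputable def coveredVerts (M : Finset (Sym2 V)) : Finset V :=
  Finset.univ.filter fun v => ∃ e ∈ M, v ∈ e

/-- `N(i)`: the set of edges of `G` sharing an endpoint with `i`, excluding `i` itself. -/
def edgeNbhd (G : SimpleGraph V) (i : Sym2 V) : Set (Sym2 V) :=
  {e | e ∈ G.edgeSet ∧ e ≠ i ∧ ∃ v : V, v ∈ e ∧ v ∈ i}

/-- `π` is a coupling of the distributions `μ` and `μ'`. -/
def IsCoupling {α : Type*} [Fintype α] (π : α × α → ℝ) (μ μ' : α → ℝ) : Prop :=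
  (∀ q, 0 ≤ π q) ∧ (∀ a, ∑ b, π (a, b) = μ a) ∧ ∀ b, ∑ a, π (a, b) = μ' b

/-- The edge-Hamming distance `|M △ M'|`. -/
noncomputable def edist (M M' : Finset (Sym2 V)) : ℕ :=
  ((M \ M') ∪ (M' \ M)).card

/-- The vertex-Hamming distance `|V(M) △ V(M')|`. -/
noncomputable def vdist (M M' : Finset (Sym2 V)) : ℕ :=
  ((coveredVerts M \ coveredVerts M') ∪ (coveredVerts M' \ coveredVerts M)).card

/-- The vertex-Hamming distance ignoring the vertex `u`: `|(V(M) △ V(M')) \ {u}|`. -/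
noncomputable def vdistErase (u : V) (M M' : Finset (Sym2 V)) : ℕ :=
  (((coveredVerts M \ coveredVerts M') ∪ (coveredVerts M' \ coveredVerts M)).erase u).card

/-- `M` satisfies the vertex pinning `(Bp, Bm)`: every vertex of `Bp` is covered by `M`
and no vertex of `Bm` is covered by `M`. -/
def satisfiesPinning (M : Finset (Sym2 V)) (Bp Bm : Finset V) : Prop :=
  (∀ w ∈ Bp, w ∈ coveredVerts M) ∧ ∀ w ∈ Bm, w ∉ coveredVerts M

/-- The Wasserstein distance between `μ` and `μ'` with respect to the metric `d`:
the infimum over couplings of the expected distance. -/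
noncomputable def wass {α : Type*} [Fintype α] (d : α → α → ℝ) (μ μ' : α → ℝ) : ℝ :=
  sInf {c : ℝ | ∃ π : α × α → ℝ, IsCoupling π μ μ' ∧ c = ∑ q : α × α, π q * d q.1 q.2}

/-- Pushing the product measure on `A × B` forward along `(a, b) ↦ (a, ψ a b)` is a coupling of
the normalized weights, as soon as `(φ, ψ)` is a weight-preserving involution of `A × B`. -/
lemma exists_coupling_of_involution {α : Type*} [Fintype α] [DecidableEq α] (A B : Finset α)
    (w : α → ℝ) (hw : ∀ a, 0 ≤ w a) (hA : 0 < ∑ a ∈ A, w a) (hB : 0 < ∑ b ∈ B, w b) (φ ψ : α → α → α)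
    (hφ : ∀ a ∈ A, ∀ b ∈ B, φ a b ∈ A) (hψ : ∀ a ∈ A, ∀ b ∈ B, ψ a b ∈ B)
    (hφφ : ∀ a ∈ A, ∀ b ∈ B, φ (φ a b) (ψ a b) = a)
    (hψψ : ∀ a ∈ A, ∀ b ∈ B, ψ (φ a b) (ψ a b) = b)
    (hww : ∀ a ∈ A, ∀ b ∈ B, w (φ a b) * w (ψ a b) = w a * w b)
    (d : α → α → ℝ) (c : ℝ) (hd : ∀ a ∈ A, ∀ b ∈ B, d a (ψ a b) ≤ c) :
    ∃ π : α × α → ℝ,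
      IsCoupling π (fun x => (∑ a ∈ A.filter fun a => a = x, w a) / ∑ a ∈ A, w a)
        (fun x => (∑ b ∈ B.filter fun b => b = x, w b) / ∑ b ∈ B, w b) ∧
      ∑ q : α × α, π q * d q.1 q.2 ≤ c := by
  set ZA := ∑ a ∈ A, w a with hZA
  set ZB := ∑ b ∈ B, w b with hZB
  have hZ : 0 < ZA * ZB := mul_pos hA hB
  have hprod (f g : α → ℝ) :
      ∑ p ∈ A ×ˢ B, f p.1 * g p.2 = (∑ a ∈ A, f a) * ∑ b ∈ B, g b := by
    rw [Finset.sum_mul_sum, Finset.sum_product]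
  have hsum : ∑ p ∈ A ×ˢ B, w p.1 * w p.2 = ZA * ZB := hprod w w
  refine ⟨fun q => (∑ p ∈ A ×ˢ B, if (p.1, ψ p.1 p.2) = q then w p.1 * w p.2 else 0) / (ZA * ZB),
    ⟨fun q => ?_, fun a => ?_, fun b => ?_⟩, ?_⟩
  · refine div_nonneg (Finset.sum_nonneg fun p _ => ?_) hZ.le
    split_ifs
    · exact mul_nonneg (hw _) (hw _)
    · exact le_rfl
  · rw [← Finset.sum_div, Finset.sum_comm, div_eq_div_iff hZ.ne' hA.ne']
    have : ∀ p : α × α, (∑ b, if (p.1, ψ p.1 p.2) = (a, b) then w p.1 * w p.2 else 0) =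
        (if p.1 = a then w p.1 else 0) * w p.2 := by
      intro p
      by_cases h : p.1 = a <;> simp [h]
    simp_rw [this]
    rw [hprod (fun x => if x = a then w x else 0) w, ← hZB, Finset.sum_filter]
    ring
  · rw [← Finset.sum_div, Finset.sum_comm, div_eq_div_iff hZ.ne' hB.ne']
    have hfst : ∀ p : α × α, (∑ a, if (p.1, ψ p.1 p.2) = (a, b) then w p.1 * w p.2 else 0) =
        if ψ p.1 p.2 = b then w p.1 * w p.2 else 0 := by
      intro p
      by_cases h : ψ p.1 p.2 = b <;> simp [h]
    simp_rw [hfst]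
    have hswap : (∑ p ∈ A ×ˢ B, if ψ p.1 p.2 = b then w p.1 * w p.2 else 0) =
        ∑ p ∈ A ×ˢ B, w p.1 * (if p.2 = b then w p.2 else 0) := by
      refine Finset.sum_nbij' (fun p => (φ p.1 p.2, ψ p.1 p.2))
        (fun p => (φ p.1 p.2, ψ p.1 p.2)) ?_ ?_ ?_ ?_ ?_
      · rintro ⟨x, y⟩ h
        rw [Finset.mem_product] at h ⊢
        exact ⟨hφ x h.1 y h.2, hψ x h.1 y h.2⟩
      · rintro ⟨x, y⟩ h
        rw [Finset.mem_product] at h ⊢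
        exact ⟨hφ x h.1 y h.2, hψ x h.1 y h.2⟩
      · rintro ⟨x, y⟩ h
        rw [Finset.mem_product] at h
        exact Prod.ext (hφφ x h.1 y h.2) (hψψ x h.1 y h.2)
      · rintro ⟨x, y⟩ h
        rw [Finset.mem_product] at h
        exact Prod.ext (hφφ x h.1 y h.2) (hψψ x h.1 y h.2)
      · rintro ⟨x, y⟩ h
        rw [Finset.mem_product] at h
        simp only [mul_ite, mul_zero, hww x h.1 y h.2]
    rw [hswap, hprod w fun x => if x = b then w x else 0, ← hZA, Finset.sum_filter]
    ring
  · simp_rw [div_mul_eq_mul_div]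
    rw [← Finset.sum_div, div_le_iff₀ hZ]
    simp_rw [Finset.sum_mul]
    rw [Finset.sum_comm, ← hsum, Finset.mul_sum]
    refine Finset.sum_le_sum fun p hp => ?_
    rw [Finset.mem_product] at hp
    simp only [ite_mul, zero_mul, Finset.sum_ite_eq, Finset.mem_univ, if_true]
    rw [mul_comm c]
    exact mul_le_mul_of_nonneg_left (hd _ hp.1 _ hp.2) (mul_nonneg (hw _) (hw _))

lemma condDist_eq {V : Type*} [Fintype V] [DecidableEq V] (G : SimpleGraph V) (lam : ℝ)
    (p : Finset (Sym2 V) → Prop) [DecidablePred p] :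
    condDist G lam p = fun N =>
      (∑ M ∈ ((matchings G).filter p).filter fun M => M = N, lam ^ M.card) /
        ∑ M ∈ (matchings G).filter p, lam ^ M.card := by
  funext N
  simp only [condDist, condDistMap, id]
  congr!

lemma mem_coveredVerts {V : Type*} [Fintype V] [DecidableEq V] {M : Finset (Sym2 V)} {w : V} :
    w ∈ coveredVerts M ↔ ∃ e ∈ M, w ∈ e := by
  simp [coveredVerts]

/-- The edge set that agrees with `N` on the edges meeting `C` and with `M` on the others. -/
noncomputable def splice {V : Type*} [DecidableEq V] (C : Set V) (M N : Finset (Sym2 V)) :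
    Finset (Sym2 V) :=
  (M.filter fun e => ¬ ∃ w ∈ e, w ∈ C) ∪ N.filter fun e => ∃ w ∈ e, w ∈ C

lemma mem_splice {V : Type*} [DecidableEq V] {C : Set V} {M N : Finset (Sym2 V)} {e : Sym2 V} :
    e ∈ splice C M N ↔ (e ∈ M ∧ ¬ ∃ w ∈ e, w ∈ C) ∨ (e ∈ N ∧ ∃ w ∈ e, w ∈ C) := by
  simp only [splice, Finset.mem_union, Finset.mem_filter]

lemma card_splice_add_card_splice {V : Type*} [DecidableEq V] (C : Set V) (M N : Finset (Sym2 V)) :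
    (splice C M N).card + (splice C N M).card = M.card + N.card := by
  have key : ∀ K L : Finset (Sym2 V), (splice C K L).card =
      (K.filter fun e => ¬ ∃ w ∈ e, w ∈ C).card + (L.filter fun e => ∃ w ∈ e, w ∈ C).card := by
    intro K L
    refine Finset.card_union_of_disjoint (Finset.disjoint_left.2 fun e he he' => ?_)
    exact (Finset.mem_filter.1 he).2 (Finset.mem_filter.1 he').2
  have hM := Finset.card_filter_add_card_filter_not (s := M) fun e => ∃ w ∈ e, w ∈ C
  have hN := Finset.card_filter_add_card_filter_not (s := N) fun e => ∃ w ∈ e, w ∈ C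
  rw [key, key]
  omega

lemma splice_splice {V : Type*} [DecidableEq V] (C : Set V) (M N : Finset (Sym2 V)) :
    splice C (splice C M N) (splice C N M) = M := by
  ext e
  simp only [mem_splice]
  by_cases h : ∃ w ∈ e, w ∈ C <;> simp [h]

lemma splice_union_splice {V : Type*} [DecidableEq V] (C : Set V) (M N : Finset (Sym2 V)) :
    splice C M N ∪ splice C N M = M ∪ N := by
  ext e
  simp only [Finset.mem_union, mem_splice]
  tauto

/-- The vertices reachable from `v` along edges in `E`. -/
def edgeComponent {V : Type*} (v : V) (E : Finset (Sym2 V)) : Set V :=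
  {w | (SimpleGraph.fromEdgeSet (E : Set (Sym2 V))).Reachable v w}

lemma mem_edgeComponent_of_mem {V : Type*} {v a b : V} {E : Finset (Sym2 V)} {e : Sym2 V}
    (he : e ∈ E) (ha : a ∈ e) (hb : b ∈ e) (hC : a ∈ edgeComponent v E) :
    b ∈ edgeComponent v E := by
  by_cases hab : a = b
  · exact hab ▸ hC
  · obtain rfl := (Sym2.mem_and_mem_iff hab).1 ⟨ha, hb⟩
    exact hC.trans (SimpleGraph.Adj.reachable ((SimpleGraph.fromEdgeSet_adj _).2 ⟨he, hab⟩))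

/-- `C` is a union of connected components of the graph with edge set `E`. -/
def IsEdgeClosed {V : Type*} (C : Set V) (E : Finset (Sym2 V)) : Prop :=
  ∀ e ∈ E, ∀ a ∈ e, ∀ b ∈ e, a ∈ C → b ∈ C

section Splice

variable {V : Type*} [DecidableEq V] {C : Set V} {M N : Finset (Sym2 V)} {w : V}

lemma mem_splice_of_mem (hw : w ∈ C) {e : Sym2 V} (hwe : w ∈ e) :
    e ∈ splice C M N ↔ e ∈ N := by
  rw [mem_splice]
  exact ⟨fun h => h.elim (fun h => (h.2 ⟨w, hwe, hw⟩).elim) And.left,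
    fun h => .inr ⟨h, w, hwe, hw⟩⟩

lemma mem_splice_of_notMem (hC : IsEdgeClosed C (M ∪ N)) (hw : w ∉ C) {e : Sym2 V}
    (hwe : w ∈ e) : e ∈ splice C M N ↔ e ∈ M := by
  rw [mem_splice]
  constructor
  · rintro (h | ⟨h, u, hu, huC⟩)
    · exact h.1
    · exact (hw (hC e (Finset.mem_union_right _ h) u hu w hwe huC)).elim
  · intro h
    refine .inl ⟨h, ?_⟩
    rintro ⟨u, hu, huC⟩
    exact hw (hC e (Finset.mem_union_left _ h) u hu w hwe huC)

lemma mem_coveredVerts_splice_of_mem [Fintype V] (hw : w ∈ C) :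
    w ∈ coveredVerts (splice C M N) ↔ w ∈ coveredVerts N := by
  simp only [mem_coveredVerts]
  exact exists_congr fun e => and_congr_left fun h => mem_splice_of_mem hw h

lemma mem_coveredVerts_splice_of_notMem [Fintype V] (hC : IsEdgeClosed C (M ∪ N))
    (hw : w ∉ C) : w ∈ coveredVerts (splice C M N) ↔ w ∈ coveredVerts M := by
  simp only [mem_coveredVerts]
  exact exists_congr fun e => and_congr_left fun h => mem_splice_of_notMem hC hw h

lemma IsMatchingSet.splice {G : SimpleGraph V} (hM : IsMatchingSet G M) (hN : IsMatchingSet G N)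
    (hC : IsEdgeClosed C (M ∪ N)) : IsMatchingSet G (splice C M N) := by
  refine ⟨fun e he => ?_, fun e he f hf hef w hwe hwf => ?_⟩
  · rcases mem_splice.1 he with h | h
    · exact hM.1 e h.1
    · exact hN.1 e h.1
  · by_cases hw : w ∈ C
    · rw [mem_splice_of_mem hw hwe] at he
      rw [mem_splice_of_mem hw hwf] at hf
      exact hN.2 e he f hf hef w hwe hwf
    · rw [mem_splice_of_notMem hC hw hwe] at he
      rw [mem_splice_of_notMem hC hw hwf] at hf
      exact hM.2 e he f hf hef w hwe hwf

lemma satisfiesPinning.splice [Fintype V] {Bp Bm : Finset V} (hM : satisfiesPinning M Bp Bm)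
    (hN : satisfiesPinning N Bp Bm) (hC : IsEdgeClosed C (M ∪ N)) :
    satisfiesPinning (splice C M N) Bp Bm := by
  refine ⟨fun w hw => ?_, fun w hw => ?_⟩ <;> by_cases hwC : w ∈ C
  · exact (mem_coveredVerts_splice_of_mem hwC).2 (hN.1 w hw)
  · exact (mem_coveredVerts_splice_of_notMem hC hwC).2 (hM.1 w hw)
  · exact fun h => hN.2 w hw ((mem_coveredVerts_splice_of_mem hwC).1 h)
  · exact fun h => hM.2 w hw ((mem_coveredVerts_splice_of_notMem hC hwC).1 h)

end Splice

lemma isEdgeClosed_edgeComponent {V : Type*} (v : V) (E : Finset (Sym2 V)) :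
    IsEdgeClosed (edgeComponent v E) E :=
  fun _ he _ ha _ hb => mem_edgeComponent_of_mem he ha hb

/-- A connected graph of maximum degree at most two has at most two vertices of degree at most
one. -/
lemma card_filter_degree_le_one_le_two {W : Type*} [Fintype W] {H : SimpleGraph W}
    (hconn : H.Connected) (hdeg : ∀ w, H.degree w ≤ 2) :
    (Finset.univ.filter fun w => H.degree w ≤ 1).card ≤ 2 := by
  have h1 := hconn.card_vert_le_card_edgeSet_add_one
  have h2 := H.sum_degrees_eq_twice_card_edges
  have h3 : ∑ w, (H.degree w + if H.degree w ≤ 1 then 1 else 0) ≤ ∑ _w : W, 2 := by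
    refine Finset.sum_le_sum fun w _ => ?_
    have := hdeg w
    split_ifs <;> omega
  rw [Finset.sum_add_distrib, ← Finset.card_filter, h2] at h3
  simp only [Finset.sum_const, Finset.card_univ, smul_eq_mul] at h3
  rw [Nat.card_eq_fintype_card, Nat.card_eq_fintype_card, ← SimpleGraph.edgeFinset_card] at h1
  omega

lemma card_filter_mk_mem_le_one {V : Type*} [Fintype V] [DecidableEq V] {G : SimpleGraph V}
    {M : Finset (Sym2 V)} (hM : IsMatchingSet G M) (w : V) :
    (Finset.univ.filter fun u => s(w, u) ∈ M).card ≤ if w ∈ coveredVerts M then 1 else 0 := by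
  split_ifs with h
  · refine Finset.card_le_one.2 fun a ha b hb => ?_
    simp only [Finset.mem_filter, Finset.mem_univ, true_and] at ha hb
    by_contra hab
    refine hM.2 _ ha _ hb (fun heq => hab (Sym2.congr_right.1 heq)) w ?_ ?_ <;> simp
  · rw [Nat.le_zero, Finset.card_eq_zero, Finset.filter_eq_empty_iff]
    exact fun u _ hu => h (mem_coveredVerts.2 ⟨_, hu, by simp⟩)

/-- Each component of the union of two matchings contains at most two vertices covered by
exactly one of them. -/
lemma card_edgeComponent_coveredVerts_le_two {V : Type*} [Fintype V] [DecidableEq V]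
    {G : SimpleGraph V} {M N : Finset (Sym2 V)} (hM : IsMatchingSet G M) (hN : IsMatchingSet G N) (v : V) :
    (Finset.univ.filter fun w => w ∈ edgeComponent v (M ∪ N) ∧
      ¬ (w ∈ coveredVerts M ↔ w ∈ coveredVerts N)).card ≤ 2 := by
  set H := SimpleGraph.fromEdgeSet ((M ∪ N : Finset (Sym2 V)) : Set (Sym2 V))
  set c := H.connectedComponentMk v
  have hbound : ∀ w : c, c.toSimpleGraph.degree w ≤
      (if (w : V) ∈ coveredVerts M then 1 else 0) + if (w : V) ∈ coveredVerts N then 1 else 0 := by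
    intro w
    refine le_trans ?_ (add_le_add (card_filter_mk_mem_le_one hM w.1)
      (card_filter_mk_mem_le_one hN w.1))
    refine le_trans ?_ (Finset.card_union_le _ _)
    rw [← SimpleGraph.card_neighborFinset_eq_degree,
      ← Finset.card_map (Function.Embedding.subtype _)]
    refine Finset.card_le_card fun u hu => ?_
    obtain ⟨u, hadj, rfl⟩ := Finset.mem_map.1 hu
    rw [SimpleGraph.mem_neighborFinset] at hadj
    simpa using ((SimpleGraph.fromEdgeSet_adj _).1 (show H.Adj w.1 u.1 from hadj)).1
  refine le_trans ?_ (card_filter_degree_le_one_le_two c.connected_toSimpleGraph fun w => ?_)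
  · rw [← Finset.card_map (Function.Embedding.subtype _)]
    refine Finset.card_le_card fun w hw => ?_
    rw [Finset.mem_filter] at hw
    obtain ⟨-, hwC, hne⟩ := hw
    have hwc : w ∈ c.supp := SimpleGraph.ConnectedComponent.sound (SimpleGraph.Reachable.symm hwC)
    refine Finset.mem_map.2 ⟨⟨w, hwc⟩, ?_, rfl⟩
    rw [Finset.mem_filter]
    refine ⟨Finset.mem_univ _, (hbound _).trans ?_⟩
    dsimp only
    split_ifs <;> simp_all
  · refine (hbound w).trans ?_
    split_ifs <;> omega

lemma vdist_splice_le_two {V : Type*} [Fintype V] [DecidableEq V] {G : SimpleGraph V}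
    {M N : Finset (Sym2 V)} (hM : IsMatchingSet G M) (hN : IsMatchingSet G N) (v : V) :
    vdist M (splice (edgeComponent v (M ∪ N)) M N) ≤ 2 := by
  refine le_trans (Finset.card_le_card fun w hw => ?_)
    (card_edgeComponent_coveredVerts_le_two hM hN v)
  have hC := isEdgeClosed_edgeComponent v (M ∪ N)
  simp only [Finset.mem_union, Finset.mem_sdiff] at hw
  rw [Finset.mem_filter]
  by_cases hwC : w ∈ edgeComponent v (M ∪ N)
  · rw [mem_coveredVerts_splice_of_mem hwC] at hw
    exact ⟨Finset.mem_univ _, hwC, by tauto⟩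
  · rw [mem_coveredVerts_splice_of_notMem hC hwC] at hw
    tauto

/-- for a vertex `v` and a vertex pinning `(Bp, Bm)` avoiding `v` with
both pinned events (`v` covered / `v` uncovered) of positive probability, there is a
coupling of the two pinned conditional distributions with expected value of
`|V(M) △ V(M')|` at most `2`. -/
theorem stmt_14 {V : Type*} [Fintype V] [DecidableEq V]
    (G : SimpleGraph V) (lam : ℝ) (hlam : 0 < lam) (v : V)
    (Bp Bm : Finset V) (hdisj : Disjoint Bp Bm) (hv : v ∉ Bp ∪ Bm)
    (hpos1 : 0 < ∑ M ∈ (matchings G).filter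
        (fun M => satisfiesPinning M Bp Bm ∧ v ∈ coveredVerts M), lam ^ M.card)
    (hpos2 : 0 < ∑ M ∈ (matchings G).filter
        (fun M => satisfiesPinning M Bp Bm ∧ v ∉ coveredVerts M), lam ^ M.card) :
    ∃ π : Finset (Sym2 V) × Finset (Sym2 V) → ℝ,
      IsCoupling π
        (condDist G lam (fun M => satisfiesPinning M Bp Bm ∧ v ∈ coveredVerts M))
        (condDist G lam (fun M => satisfiesPinning M Bp Bm ∧ v ∉ coveredVerts M)) ∧
      ∑ q : Finset (Sym2 V) × Finset (Sym2 V), π q * (vdist q.1 q.2 : ℝ) ≤ 2 := by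
  have hvC : ∀ E : Finset (Sym2 V), v ∈ edgeComponent v E :=
    fun E => SimpleGraph.Reachable.refl (G := SimpleGraph.fromEdgeSet (E : Set (Sym2 V))) v
  have hclosed (M N : Finset (Sym2 V)) := isEdgeClosed_edgeComponent v (M ∪ N)
  rw [condDist_eq, condDist_eq]
  refine exists_coupling_of_involution _ _ (fun M => lam ^ M.card) (fun M => by positivity)
    hpos1 hpos2 (fun M N => splice (edgeComponent v (M ∪ N)) N M)
    (fun M N => splice (edgeComponent v (M ∪ N)) M N) ?_ ?_ ?_ ?_ ?_
    (fun M N => (vdist M N : ℝ)) 2 ?_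
  · intro M hM N hN
    simp only [matchings, Finset.mem_filter, Finset.mem_univ, true_and] at hM hN ⊢
    have hC : IsEdgeClosed (edgeComponent v (M ∪ N)) (N ∪ M) :=
      Finset.union_comm M N ▸ hclosed M N
    exact ⟨hN.1.splice hM.1 hC, hN.2.1.splice hM.2.1 hC,
      (mem_coveredVerts_splice_of_mem (hvC _)).2 hM.2.2⟩
  · intro M hM N hN
    simp only [matchings, Finset.mem_filter, Finset.mem_univ, true_and] at hM hN ⊢
    exact ⟨hM.1.splice hN.1 (hclosed M N), hM.2.1.splice hN.2.1 (hclosed M N),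
      fun h => hN.2.2 ((mem_coveredVerts_splice_of_mem (hvC _)).1 h)⟩
  · intro M _ N _
    rw [Finset.union_comm (splice _ N M), splice_union_splice, splice_splice]
  · intro M _ N _
    rw [Finset.union_comm (splice _ N M), splice_union_splice, splice_splice]
  · intro M _ N _
    rw [← pow_add, ← pow_add, add_comm, card_splice_add_card_splice]
  · intro M hM N hN
    simp only [matchings, Finset.mem_filter, Finset.mem_univ, true_and] at hM hN
    exact_mod_cast vdist_splice_le_two hM.1 hN.1 v

end SensMatching
end

section
/- There exist constants ε₀ > 0 and c > 0 such that for all 0 < ε < ε₀ and all λ > 0 the following holds: if for every finite simple graph G the expected matching size under the Gibbs distribution satisfies (Σ_{k≥0} k·m_k(G)·λ^k)/(Σ_{k≥0} m_k(G)·λ^k) ≥ (1 − ε)·ν(G), then λ ≥ 2^{c/ε}. -/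
open scoped Classical

namespace SensMatching

variable {V : Type*} [Fintype V] [DecidableEq V]

/-- The half graph on `n + n` vertices: `inl i` is adjacent to `inr j` when `i ≤ j`. -/
def halfGraph (n : ℕ) : SimpleGraph (Fin n ⊕ Fin n) :=
  SimpleGraph.fromRel fun x y => ∃ i j, x = Sum.inl i ∧ y = Sum.inr j ∧ i ≤ j

lemma mem_edgeSet_halfGraph {n : ℕ} {e : Sym2 (Fin n ⊕ Fin n)} :
    e ∈ (halfGraph n).edgeSet ↔ ∃ i j : Fin n, i ≤ j ∧ e = s(Sum.inl i, Sum.inr j) := by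
  induction e with | _ x y => ?_
  rw [SimpleGraph.mem_edgeSet, halfGraph, SimpleGraph.fromRel_adj]
  constructor
  · rintro ⟨-, ⟨i, j, rfl, rfl, h⟩ | ⟨i, j, rfl, rfl, h⟩⟩
    · exact ⟨i, j, h, rfl⟩
    · exact ⟨i, j, h, Sym2.eq_swap⟩
  · rintro ⟨i, j, h, he⟩
    rcases Sym2.eq_iff.1 he with ⟨rfl, rfl⟩ | ⟨rfl, rfl⟩
    · exact ⟨by simp, Or.inl ⟨i, j, rfl, rfl, h⟩⟩
    · exact ⟨by simp, Or.inr ⟨i, j, rfl, rfl, h⟩⟩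

lemma mem_matchings {W : Type*} [Fintype W] {G : SimpleGraph W} {M : Finset (Sym2 W)} :
    M ∈ matchings G ↔ IsMatchingSet G M := by
  simp [matchings]

lemma IsMatchingSet.eq_of_mem {W : Type*} {G : SimpleGraph W} {M : Finset (Sym2 W)}
    (hM : IsMatchingSet G M) {e f : Sym2 W} (he : e ∈ M) (hf : f ∈ M) {v : W} (hve : v ∈ e) (hvf : v ∈ f) : e = f := by
  by_contra h
  exact hM.2 e he f hf h v hve hvf

/-- The edges `{f j, j}` for `j ∈ J`, between the two sides of a bipartite vertex set. -/
def edgesOfFun {n : ℕ} (f : Fin n → Fin n) (J : Finset (Fin n)) :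
    Finset (Sym2 (Fin n ⊕ Fin n)) :=
  J.image fun j => s(Sum.inl (f j), Sum.inr j)

lemma mk_mem_edgesOfFun {n : ℕ} {f : Fin n → Fin n} {J : Finset (Fin n)} {i j : Fin n} :
    s(Sum.inl i, Sum.inr j) ∈ edgesOfFun f J ↔ j ∈ J ∧ f j = i := by
  simp [edgesOfFun]

lemma card_edgesOfFun {n : ℕ} (f : Fin n → Fin n) (J : Finset (Fin n)) :
    (edgesOfFun f J).card = J.card := by
  refine Finset.card_image_of_injective _ fun i j h => ?_
  have : f i = f j ∧ i = j := by simpa using h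
  exact this.2

lemma isMatchingSet_edgesOfFun {n : ℕ} {f : Fin n → Fin n} {J : Finset (Fin n)}
    (hle : ∀ j ∈ J, f j ≤ j) (hinj : Set.InjOn f J) :
    IsMatchingSet (halfGraph n) (edgesOfFun f J) := by
  constructor
  · intro e he
    obtain ⟨j, hj, rfl⟩ := Finset.mem_image.1 he
    exact mem_edgeSet_halfGraph.2 ⟨_, _, hle j hj, rfl⟩
  · intro e he e' he' hne v hv hv'
    obtain ⟨j, hj, rfl⟩ := Finset.mem_image.1 he
    obtain ⟨k, hk, rfl⟩ := Finset.mem_image.1 he'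
    apply hne
    have : j = k := by
      rcases v with v | v
      · refine hinj hj hk ?_
        simp only [Sym2.mem_iff, Sum.inl.injEq, reduceCtorEq, or_false] at hv hv'
        exact hv.symm.trans hv'
      · simp only [Sym2.mem_iff, Sum.inr.injEq, reduceCtorEq, false_or] at hv hv'
        exact hv.symm.trans hv'
    rw [this]

lemma IsMatchingSet.exists_edgesOfFun {n : ℕ} {M : Finset (Sym2 (Fin n ⊕ Fin n))}
    (hM : IsMatchingSet (halfGraph n) M) :
    ∃ (f : Fin n → Fin n) (J : Finset (Fin n)), (∀ j ∈ J, f j ≤ j) ∧ Set.InjOn f J ∧ M = edgesOfFun f J := by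
  have key : ∀ j : Fin n, ∃ i, (∃ i', s(Sum.inl i', Sum.inr j) ∈ M) →
      s(Sum.inl i, Sum.inr j) ∈ M := fun j => by
    by_cases h : ∃ i', s(Sum.inl i', Sum.inr j) ∈ M
    · exact ⟨h.choose, fun _ => h.choose_spec⟩
    · exact ⟨j, fun h' => absurd h' h⟩
  choose f hf using key
  refine ⟨f, Finset.univ.filter fun j => ∃ i', s(Sum.inl i', Sum.inr j) ∈ M, ?_, ?_, ?_⟩
  · intro j hj
    obtain ⟨i, k, hik, h⟩ := mem_edgeSet_halfGraph.1 (hM.1 _ (hf j (Finset.mem_filter.1 hj).2))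
    simp only [Sym2.eq_iff, Sum.inl.injEq, Sum.inr.injEq, reduceCtorEq, and_false, or_false] at h
    rw [h.1, h.2]
    exact hik
  · intro j hj k hk hjk
    have hj' := hf j (Finset.mem_filter.1 hj).2
    have hk' := hf k (Finset.mem_filter.1 hk).2
    have := hM.eq_of_mem (v := Sum.inl (f j)) hj' hk' (by simp) (by simp [hjk])
    simp only [Sym2.eq_iff, Sum.inl.injEq, Sum.inr.injEq, reduceCtorEq, and_false, or_false] at this
    exact this.2
  · ext e
    constructor
    · intro he
      obtain ⟨i, j, -, rfl⟩ := mem_edgeSet_halfGraph.1 (hM.1 e he)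
      have hj : ∃ i', s(Sum.inl i', Sum.inr j) ∈ M := ⟨i, he⟩
      refine mk_mem_edgesOfFun.2 ⟨by simpa using hj, ?_⟩
      have := hM.eq_of_mem (v := Sum.inr j) (hf j hj) he (by simp) (by simp)
      simp only [Sym2.eq_iff, Sum.inl.injEq, reduceCtorEq, and_false, or_false,
        and_true] at this
      exact this
    · intro he
      obtain ⟨j, hj, rfl⟩ := Finset.mem_image.1 he
      exact hf j (Finset.mem_filter.1 hj).2

lemma eq_id_of_injective_of_le {n : ℕ} {f : Fin n → Fin n} (hinj : Function.Injective f)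
    (hle : ∀ j, f j ≤ j) : f = id := by
  funext j
  induction j using WellFoundedLT.induction with
  | ind j ih =>
    rcases (hle j).lt_or_eq with h | h
    · exact absurd (hinj (ih _ h)) h.ne
    · exact h

lemma edgesOfFun_id_mem_matchings (n : ℕ) :
    edgesOfFun id Finset.univ ∈ matchings (halfGraph n) :=
  mem_matchings.2 (isMatchingSet_edgesOfFun (fun _ _ => le_rfl) Function.injective_id.injOn)

lemma nu_halfGraph (n : ℕ) : nu (halfGraph n) = n := by
  apply le_antisymm
  · refine Finset.sup_le fun M hM => ?_
    obtain ⟨f, J, -, -, rfl⟩ := (mem_matchings.1 hM).exists_edgesOfFun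
    rw [card_edgesOfFun]
    simpa using J.card_le_univ
  · have := Finset.le_sup (f := Finset.card) (edgesOfFun_id_mem_matchings n)
    rwa [card_edgesOfFun, Finset.card_univ, Fintype.card_fin] at this

lemma numMatchings_halfGraph_self (n : ℕ) : numMatchings (halfGraph n) n = 1 := by
  rw [numMatchings, Finset.card_eq_one]
  refine ⟨edgesOfFun id Finset.univ, Finset.eq_singleton_iff_unique_mem.2 ⟨?_, ?_⟩⟩
  · exact Finset.mem_filter.2 ⟨edgesOfFun_id_mem_matchings n, by simp [card_edgesOfFun]⟩
  · intro M hM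
    obtain ⟨hM, hcard⟩ := Finset.mem_filter.1 hM
    obtain ⟨f, J, hle, hinj, rfl⟩ := (mem_matchings.1 hM).exists_edgesOfFun
    rw [card_edgesOfFun] at hcard
    obtain rfl : J = Finset.univ := by
      rw [← Finset.card_eq_iff_eq_univ, hcard, Fintype.card_fin]
    rw [eq_id_of_injective_of_le (f := f) (by simpa using hinj) (by simpa using hle)]

/-- The map sending each `j ∈ S` to its predecessor in `insert 0 S` and fixing every other `j`. -/
noncomputable def predIn {n : ℕ} (S : Finset (Fin (n + 1))) (j : Fin (n + 1)) : Fin (n + 1) :=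
  if j ∈ S then (S.filter (· < j)).sup id else j

lemma predIn_of_notMem {n : ℕ} {S : Finset (Fin (n + 1))} {j : Fin (n + 1)} (h : j ∉ S) :
    predIn S j = j :=
  if_neg h

lemma predIn_lt {n : ℕ} {S : Finset (Fin (n + 1))} {j : Fin (n + 1)} (h : j ∈ S) (h0 : j ≠ 0) :
    predIn S j < j := by
  rw [predIn, if_pos h, Finset.sup_lt_iff (bot_lt_iff_ne_bot.2 h0)]
  exact fun i hi => (Finset.mem_filter.1 hi).2

lemma predIn_mem {n : ℕ} {S : Finset (Fin (n + 1))} {j : Fin (n + 1)} (h : j ∈ S) :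
    predIn S j ∈ insert 0 S := by
  rw [predIn, if_pos h]
  rcases (S.filter (· < j)).eq_empty_or_nonempty with h' | h'
  · rw [h', Finset.sup_empty]
    exact Finset.mem_insert_self _ _
  · obtain ⟨i, hi, he⟩ := Finset.exists_mem_eq_sup _ h' id
    rw [he]
    exact Finset.mem_insert_of_mem (Finset.mem_filter.1 hi).1

lemma le_predIn {n : ℕ} {S : Finset (Fin (n + 1))} {i j : Fin (n + 1)} (hi : i ∈ S) (hj : j ∈ S)
    (hij : i < j) : i ≤ predIn S j := by
  rw [predIn, if_pos hj]
  exact Finset.le_sup (f := id) (Finset.mem_filter.2 ⟨hi, hij⟩)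

lemma predIn_le {n : ℕ} {S : Finset (Fin (n + 1))} {j : Fin (n + 1)} (h0 : j ≠ 0) :
    predIn S j ≤ j := by
  by_cases h : j ∈ S
  · exact (predIn_lt h h0).le
  · exact (predIn_of_notMem h).le

lemma predIn_injOn {n : ℕ} (S : Finset (Fin (n + 1))) :
    Set.InjOn (predIn S) {j | j ≠ 0} := by
  have notMem_of_eq : ∀ j k, j ∈ S → k ∉ S → k ≠ 0 → predIn S j ≠ predIn S k := by
    intro j k hj hk hk0 h
    have := predIn_mem hj
    rw [h, predIn_of_notMem hk, Finset.mem_insert] at this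
    exact this.elim hk0 hk
  have lt_of_lt : ∀ j k, j ∈ S → k ∈ S → j ≠ 0 → j < k → predIn S j ≠ predIn S k :=
    fun j k hj hk hj0 hjk => ((predIn_lt hj hj0).trans_le (le_predIn hj hk hjk)).ne
  intro j hj0 k hk0 h
  by_cases hj : j ∈ S <;> by_cases hk : k ∈ S
  · rcases lt_trichotomy j k with hjk | hjk | hjk
    · exact absurd h (lt_of_lt j k hj hk hj0 hjk)
    · exact hjk
    · exact absurd h.symm (lt_of_lt k j hk hj hk0 hjk)
  · exact absurd h (notMem_of_eq j k hj hk hk0)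
  · exact absurd h.symm (notMem_of_eq k j hk hj hj0)
  · rwa [predIn_of_notMem hj, predIn_of_notMem hk] at h

lemma two_pow_le_numMatchings_halfGraph (n : ℕ) :
    2 ^ n ≤ numMatchings (halfGraph (n + 1)) n := by
  have hcard : (Finset.univ.erase (0 : Fin (n + 1))).card = n := by simp
  nth_rw 1 [← hcard]
  rw [← Finset.card_powerset]
  refine Finset.card_le_card_of_injOn
    (fun S => edgesOfFun (predIn S) (Finset.univ.erase 0)) ?_ ?_
  · intro S _
    refine Finset.mem_filter.2 ⟨mem_matchings.2 (isMatchingSet_edgesOfFun ?_ ?_), ?_⟩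
    · exact fun j hj => predIn_le (Finset.ne_of_mem_erase hj)
    · exact (predIn_injOn S).mono fun j hj => Finset.ne_of_mem_erase hj
    · rw [card_edgesOfFun, hcard]
  · intro S hS T hT h
    have mem_iff : ∀ U : Finset (Fin (n + 1)), U ∈ (Finset.univ.erase 0).powerset → ∀ j,
        j ∈ U ↔ j ≠ 0 ∧
          s(Sum.inl j, Sum.inr j) ∉ edgesOfFun (predIn U) (Finset.univ.erase 0) := by
      intro U hU j
      rw [mk_mem_edgesOfFun]
      constructor
      · intro hj
        have hj0 := Finset.ne_of_mem_erase (Finset.mem_powerset.1 hU hj)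
        exact ⟨hj0, fun h => (predIn_lt hj hj0).ne h.2⟩
      · rintro ⟨hj0, h⟩
        by_contra hj
        exact h ⟨by simpa using hj0, predIn_of_notMem hj⟩
    ext j
    rw [mem_iff S hS, mem_iff T hT]
    simp only at h
    rw [h]

/-- If a distribution on `{0, …, n + 1}` with weights `m k * lam ^ k` has mean within `1 / 2` of
the maximum, then the weight at `n` is at most the weight at `n + 1`. -/
lemma le_of_mean_ge {n : ℕ} {m : ℕ → ℕ} (hm : m (n + 1) = 1) {lam x : ℝ} (hlam : 0 < lam)
    (hx : (n : ℝ) + 1 / 2 ≤ x)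
    (h : x ≤ (∑ k ∈ Finset.range (n + 2), (k : ℝ) * (m k : ℝ) * lam ^ k) /
      ∑ k ∈ Finset.range (n + 2), (m k : ℝ) * lam ^ k) : (m n : ℝ) ≤ lam := by
  have hZ : 0 < ∑ k ∈ Finset.range (n + 2), (m k : ℝ) * lam ^ k := by
    refine Finset.sum_pos' (fun k _ => by positivity) ⟨n + 1, by simp, ?_⟩
    rw [hm]
    positivity
  have hsum := (le_div_iff₀ hZ).1 (hx.trans h)
  rw [Finset.mul_sum, ← sub_nonneg, ← Finset.sum_sub_distrib, Finset.sum_range_succ,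
    Finset.sum_range_succ, hm] at hsum
  have hrest : ∑ k ∈ Finset.range n,
      ((k : ℝ) * (m k : ℝ) * lam ^ k - ((n : ℝ) + 1 / 2) * ((m k : ℝ) * lam ^ k)) ≤ 0 := by
    refine Finset.sum_nonpos fun k hk => ?_
    have hkn : (k : ℝ) ≤ n := by exact_mod_cast (Finset.mem_range.1 hk).le
    have hw : 0 ≤ (m k : ℝ) * lam ^ k := by positivity
    nlinarith
  push_cast at hsum
  refine le_of_mul_le_mul_right ?_ (pow_pos hlam n)
  rw [← pow_succ']
  linarith

/-- there are constants `ε₀ > 0` and `c > 0` such that for all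
`0 < ε < ε₀` and `λ > 0`: if for every finite simple graph the expected Gibbs matching
size is at least `(1 − ε)·ν(G)`, then `λ ≥ 2^{c/ε}`. -/
theorem stmt_18 :
    ∃ ε₀ c : ℝ, 0 < ε₀ ∧ 0 < c ∧
      ∀ ε : ℝ, 0 < ε → ε < ε₀ → ∀ lam : ℝ, 0 < lam →
        (∀ (V : Type) [Fintype V] [DecidableEq V] (G : SimpleGraph V),
          (1 - ε) * (nu G : ℝ) ≤
            (∑ k ∈ Finset.range (nu G + 1), (k : ℝ) * (numMatchings G k : ℝ) * lam ^ k) /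
              ∑ k ∈ Finset.range (nu G + 1), (numMatchings G k : ℝ) * lam ^ k) →
        (2 : ℝ) ^ (c / ε) ≤ lam := by
  refine ⟨1 / 8, 1 / 4, by norm_num, by norm_num, fun ε hε hε' lam hlam h => ?_⟩
  have hinv : 4 ≤ 1 / (2 * ε) := by
    rw [le_div_iff₀ (by positivity)]
    linarith
  obtain ⟨n, hn⟩ : ∃ n, ⌊1 / (2 * ε)⌋₊ = n + 1 :=
    Nat.exists_eq_succ_of_ne_zero (Nat.floor_pos.2 (by linarith)).ne'
  have hle : (n : ℝ) + 1 ≤ 1 / (2 * ε) := by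
    have := Nat.floor_le (a := 1 / (2 * ε)) (by positivity)
    rw [hn] at this
    exact_mod_cast this
  have hlt : 1 / (2 * ε) < (n : ℝ) + 2 := by
    have := Nat.lt_floor_add_one (1 / (2 * ε))
    rw [hn] at this
    push_cast at this
    linarith
  have hG := h _ (halfGraph (n + 1))
  rw [nu_halfGraph] at hG
  have hmean : (n : ℝ) + 1 / 2 ≤ (1 - ε) * ((n + 1 : ℕ) : ℝ) := by
    rw [le_div_iff₀ (by positivity)] at hle
    push_cast
    linarith
  have hexp : 1 / 4 / ε ≤ (n : ℝ) := by
    have : 1 / (2 * ε) = 2 * (1 / 4 / ε) := by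
      field_simp
      norm_num
    linarith
  calc (2 : ℝ) ^ (1 / 4 / ε) ≤ 2 ^ (n : ℝ) := Real.rpow_le_rpow_of_exponent_le one_le_two hexp
    _ = ((2 ^ n : ℕ) : ℝ) := by rw [Real.rpow_natCast]; push_cast; rfl
    _ ≤ (numMatchings (halfGraph (n + 1)) n : ℝ) := by
      exact_mod_cast two_pow_le_numMatchings_halfGraph n
    _ ≤ lam := le_of_mean_ge (numMatchings_halfGraph_self _) hlam hmean hG

end SensMatching
end
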